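/- Fix n ≥ 1 and let π = ω_{i₁,c₁}⋯ω_{i_k,c_k} ∈ P_n⁺ with i₁,…,i_k ∈ [1,n] and c₁ < ⋯ < c_k be a prime snake, and set *π = ω_{n+1−i₁,c₁−n−1}⋯ω_{n+1−i_k,c_k−n−1} ∈ P_n⁺. If (p₁,…,p_k) ∈ 𝙿_π and (g₁,…,g_k) ∈ 𝙿_{*π} satisfy ω(p₁)⋯ω(p_k) · ω(g₁)⋯ω(g_k) = 1 in P_n, then ω(p_t) = ω_{i_t,c_t} and ω(g_t) = ω_{i_t,c_t}^{−1} for every t ∈ [1,k]. -/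

import Mathlib

/-- `p : {0,…,N+1} → ℤ` (modelled on `ℕ`) is a path in `𝙿^{(N)}_{i,a}`. -/
def IsPath (N i : ℕ) (a : ℤ) (p : ℕ → ℤ) : Prop :=
  p 0 = (i : ℤ) + a ∧ p (N + 1) = (N : ℤ) + 1 - i + a ∧
    ∀ r : ℕ, r ≤ N → (p (r + 1) - p r = 1 ∨ p (r + 1) - p r = -1)

/-- The weight `ω(p) = ∏_{r ∈ C_p⁺} ω_{r,p(r)} ∏_{r ∈ C_p⁻} ω_{r,p(r)}⁻¹` of a path,
as an element of the free abelian group `P_N` modelled additively on `(ℤ × ℤ) →₀ ℤ`. -/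
noncomputable def wt (N : ℕ) (p : ℕ → ℤ) : (ℤ × ℤ) →₀ ℤ :=
  (∑ r ∈ Finset.Icc 1 N,
      if p (r - 1) = p r + 1 ∧ p (r + 1) = p r + 1 then
        Finsupp.single ((r : ℤ), p r) 1 else 0)
  - ∑ r ∈ Finset.Icc 1 N,
      if p (r - 1) = p r - 1 ∧ p (r + 1) = p r - 1 then
        Finsupp.single ((r : ℤ), p r) 1 else 0

/-- A tuple `(P 1, …, P k) ∈ 𝙿_ω` for `ω = ω_{idx 1, a 1} ⋯ ω_{idx k, a k}`:
each `P t` is a path in `𝙿^{(N)}_{idx t, a t}`, and `P t m < P u m` for all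
`t < u` and all `m ∈ [0, N+1]`. -/
def IsTuple (N k : ℕ) (idx : ℕ → ℕ) (a : ℕ → ℤ) (P : ℕ → ℕ → ℤ) : Prop :=
  (∀ t : ℕ, 1 ≤ t → t ≤ k → IsPath N (idx t) (a t) (P t)) ∧
  (∀ t u : ℕ, 1 ≤ t → t < u → u ≤ k → ∀ m : ℕ, m ≤ N + 1 → P t m < P u m)

/-- The set `S_{m,r,N} = {2q+2-m-r : max(m,r) ≤ q ≤ min(m+r-1, N)} ⊆ ℤ`. -/
def Ssn (m r N : ℕ) : Set ℤ :=
  {x | ∃ q : ℕ, max m r ≤ q ∧ q ≤ min (m + r - 1) N ∧ x = 2 * (q : ℤ) + 2 - m - r}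

def hh (p : ℕ → ℤ) (r : ℕ) (x : ℤ) : ℤ := if x < p r ∧ (p r - x) % 2 = 1 then 1 else 0

lemma wt_apply_in (N : ℕ) (p : ℕ → ℤ) (r : ℕ) (h1 : 1 ≤ r) (h2 : r ≤ N) (x : ℤ) :
    wt N p ((r : ℤ), x) =
      (if (p (r - 1) = p r + 1 ∧ p (r + 1) = p r + 1) ∧ p r = x then 1 else 0)
      - (if (p (r - 1) = p r - 1 ∧ p (r + 1) = p r - 1) ∧ p r = x then 1 else 0) := by
  unfold wt
  rw [Finsupp.sub_apply, Finsupp.finsetSum_apply, Finsupp.finsetSum_apply]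
  congr 1
  · rw [Finset.sum_eq_single r]
    · by_cases h : (p (r - 1) = p r + 1 ∧ p (r + 1) = p r + 1)
      · simp [h, Finsupp.single_apply]
      · simp [h]
    · intro b _ hb
      split_ifs
      · rw [Finsupp.single_apply, if_neg]
        intro h
        apply hb
        have := (Prod.mk.inj h).1
        exact_mod_cast this
      · rfl
    · intro h
      exact absurd (Finset.mem_Icc.2 ⟨h1, h2⟩) h
  · rw [Finset.sum_eq_single r]
    · by_cases h : (p (r - 1) = p r - 1 ∧ p (r + 1) = p r - 1)
      · simp [h, Finsupp.single_apply]
      · simp [h]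
    · intro b _ hb
      split_ifs
      · rw [Finsupp.single_apply, if_neg]
        intro h
        apply hb
        have := (Prod.mk.inj h).1
        exact_mod_cast this
      · rfl
    · intro h
      exact absurd (Finset.mem_Icc.2 ⟨h1, h2⟩) h

lemma wt_apply_out (N : ℕ) (p : ℕ → ℤ) (a x : ℤ) (h : ¬ (1 ≤ a ∧ a ≤ N)) :
    wt N p (a, x) = 0 := by
  unfold wt
  rw [Finsupp.sub_apply, Finsupp.finsetSum_apply, Finsupp.finsetSum_apply]
  rw [Finset.sum_eq_zero, Finset.sum_eq_zero, sub_zero]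
  all_goals
    intro r hr
    rw [Finset.mem_Icc] at hr
    split_ifs
    · rw [Finsupp.single_apply, if_neg]
      intro h'
      have := (Prod.mk.inj h').1
      omega
    · rfl

lemma wt_congr (N : ℕ) (p q : ℕ → ℤ) (h : ∀ r, r ≤ N + 1 → p r = q r) : wt N p = wt N q := by
  unfold wt
  congr 1
  all_goals
    apply Finset.sum_congr rfl
    intro r hr
    rw [Finset.mem_Icc] at hr
    rw [h (r - 1) (by omega), h r (by omega), h (r + 1) (by omega)]

lemma wt_top (n i : ℕ) (h1 : 1 ≤ i) (h2 : i ≤ n) (c : ℤ) :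
    wt n (fun r => c + |(r : ℤ) - i|) = Finsupp.single ((i : ℤ), c) 1 := by
  ext ⟨a, x⟩
  by_cases ha : 1 ≤ a ∧ a ≤ n
  · obtain ⟨r, rfl⟩ := Int.eq_ofNat_of_zero_le (show 0 ≤ a by omega)
    rw [wt_apply_in _ _ _ (by omega) (by omega), Finsupp.single_apply]
    simp only [Prod.mk.injEq]
    have e : ((r - 1 : ℕ) : ℤ) = (r : ℤ) - 1 := by omega
    rw [e]
    push_cast
    rcases lt_trichotomy r i with h | h | h
    · rw [abs_of_neg (show (r : ℤ) - i < 0 by omega),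
        abs_of_neg (show (r : ℤ) - 1 - i < 0 by omega),
        abs_of_nonpos (show (r : ℤ) + 1 - i ≤ 0 by omega)]
      split_ifs <;> omega
    · subst h
      simp
      omega
    · rw [abs_of_pos (show 0 < (r : ℤ) - i by omega),
        abs_of_nonneg (show 0 ≤ (r : ℤ) - 1 - i by omega),
        abs_of_pos (show 0 < (r : ℤ) + 1 - i by omega)]
      split_ifs <;> omega
  · rw [wt_apply_out _ _ _ _ ha, Finsupp.single_apply, if_neg]
    intro h
    have := (Prod.mk.inj h).1
    omega

lemma wt_bot (n i : ℕ) (h1 : 1 ≤ i) (h2 : i ≤ n) (c : ℤ) :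
    wt n (fun r => c - |(r : ℤ) - i|) = - Finsupp.single ((i : ℤ), c) 1 := by
  ext ⟨a, x⟩
  rw [Finsupp.neg_apply]
  by_cases ha : 1 ≤ a ∧ a ≤ n
  · obtain ⟨r, rfl⟩ := Int.eq_ofNat_of_zero_le (show 0 ≤ a by omega)
    rw [wt_apply_in _ _ _ (by omega) (by omega), Finsupp.single_apply]
    simp only [Prod.mk.injEq]
    have e : ((r - 1 : ℕ) : ℤ) = (r : ℤ) - 1 := by omega
    rw [e]
    push_cast
    rcases lt_trichotomy r i with h | h | h
    · rw [abs_of_neg (show (r : ℤ) - i < 0 by omega),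
        abs_of_neg (show (r : ℤ) - 1 - i < 0 by omega),
        abs_of_nonpos (show (r : ℤ) + 1 - i ≤ 0 by omega)]
      split_ifs <;> omega
    · subst h
      simp
      omega
    · rw [abs_of_pos (show 0 < (r : ℤ) - i by omega),
        abs_of_nonneg (show 0 ≤ (r : ℤ) - 1 - i by omega),
        abs_of_pos (show 0 < (r : ℤ) + 1 - i by omega)]
      split_ifs <;> omega
  · rw [wt_apply_out _ _ _ _ ha, Finsupp.single_apply, if_neg, neg_zero]
    intro h
    have := (Prod.mk.inj h).1
    omega

lemma path_top (n i : ℕ) (h1 : 1 ≤ i) (h2 : i ≤ n) (c : ℤ) :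
    IsPath n i c (fun r => c + |(r : ℤ) - i|) := by
  refine ⟨?_, ?_, ?_⟩
  · simp; omega
  · push_cast
    rw [abs_of_nonneg (by omega)]; ring
  · intro r hr
    push_cast
    rcases lt_or_ge r i with h | h
    · rw [abs_of_neg (show (r : ℤ) - i < 0 by omega),
        abs_of_nonpos (show (r : ℤ) + 1 - i ≤ 0 by omega)]
      omega
    · rw [abs_of_nonneg (show 0 ≤ (r : ℤ) - i by omega),
        abs_of_pos (show 0 < (r : ℤ) + 1 - i by omega)]
      omega

lemma path_bot (n i : ℕ) (h1 : 1 ≤ i) (h2 : i ≤ n) (c : ℤ) :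
    IsPath n (n + 1 - i) (c - n - 1) (fun r => c - |(r : ℤ) - i|) := by
  have e : ((n + 1 - i : ℕ) : ℤ) = (n : ℤ) + 1 - i := by omega
  refine ⟨?_, ?_, ?_⟩
  · rw [e]; simp; ring
  · rw [e]; push_cast
    rw [abs_of_nonneg (by omega)]; ring
  · intro r hr
    push_cast
    rcases lt_or_ge r i with h | h
    · rw [abs_of_neg (show (r : ℤ) - i < 0 by omega),
        abs_of_nonpos (show (r : ℤ) + 1 - i ≤ 0 by omega)]
      omega
    · rw [abs_of_nonneg (show 0 ≤ (r : ℤ) - i by omega),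
        abs_of_pos (show 0 < (r : ℤ) + 1 - i by omega)]
      omega

lemma lip {N i : ℕ} {a : ℤ} {p : ℕ → ℤ} (h : IsPath N i a p) (r d : ℕ) (hr : r + d ≤ N + 1) :
    p (r + d) ≤ p r + d ∧ p r - d ≤ p (r + d) := by
  induction d with
  | zero => simp
  | succ d ih =>
    have := ih (by omega)
    have h3 := h.2.2 (r + d) (by omega)
    rw [← add_assoc]
    push_cast
    omega

lemma lip_abs {N i : ℕ} {a : ℤ} {p : ℕ → ℤ} (h : IsPath N i a p) (r s : ℕ) (hr : r ≤ N + 1)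
    (hs : s ≤ N + 1) : p r ≤ p s + |(r : ℤ) - s| := by
  rcases le_total r s with hl | hl
  · obtain ⟨d, rfl⟩ := Nat.exists_eq_add_of_le hl
    have := lip h r d hs
    rw [abs_of_nonpos (by omega)]
    push_cast
    omega
  · obtain ⟨d, rfl⟩ := Nat.exists_eq_add_of_le hl
    have := lip h s d hr
    rw [abs_of_nonneg (by omega)]
    push_cast
    omega

lemma par {N i : ℕ} {a : ℤ} {p q : ℕ → ℤ} (h : IsPath N i a p) (h' : IsPath N i a q)
    (r : ℕ) (hr : r ≤ N + 1) : (p r - q r) % 2 = 0 := by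
  induction r with
  | zero => rw [h.1, h'.1]; simp
  | succ r ih =>
    have := ih (by omega)
    have h3 := h.2.2 r (by omega)
    have h4 := h'.2.2 r (by omega)
    omega

lemma top_le {n i : ℕ} {c : ℤ} {p : ℕ → ℤ} (h : IsPath n i c p)
    (r : ℕ) (hr : r ≤ n + 1) : c + |(r : ℤ) - i| ≤ p r := by
  have h0 := lip h 0 r (by omega)
  have h1 := lip h r (n + 1 - r) (by omega)
  rw [show r + (n + 1 - r) = n + 1 by omega] at h1
  rw [zero_add] at h0
  have a1 := h.1
  have a2 := h.2.1
  rcases le_total r i with hl | hl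
  · rw [abs_of_nonpos (by omega)]; omega
  · rw [abs_of_nonneg (by omega)]; omega

lemma le_bot' {n i : ℕ} (h2 : i ≤ n) {c : ℤ} {p : ℕ → ℤ}
    (h : IsPath n (n + 1 - i) (c - n - 1) p)
    (r : ℕ) (hr : r ≤ n + 1) : p r ≤ c - |(r : ℤ) - i| := by
  have h0 := lip h 0 r (by omega)
  have h1 := lip h r (n + 1 - r) (by omega)
  rw [show r + (n + 1 - r) = n + 1 by omega] at h1
  rw [zero_add] at h0
  have a1 := h.1
  have a2 := h.2.1
  rcases le_total r i with hl | hl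
  · rw [abs_of_nonpos (by omega)]; omega
  · rw [abs_of_nonneg (by omega)]; omega

set_option maxHeartbeats 4000000 in
lemma hh_wave {N i : ℕ} {a : ℤ} {p : ℕ → ℤ} (h : IsPath N i a p) (r : ℕ) (h1 : 1 ≤ r)
    (h2 : r ≤ N) (x : ℤ) :
    hh p (r - 1) x + hh p (r + 1) x - hh p r (x - 1) - hh p r (x + 1) = wt N p ((r : ℤ), x) := by
  rw [wt_apply_in N p r h1 h2]
  have e1 := h.2.2 (r - 1) (by omega)
  have e2 := h.2.2 r h2
  rw [show r - 1 + 1 = r by omega] at e1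
  unfold hh
  generalize p (r - 1) = A at *
  generalize p (r + 1) = B at *
  generalize p r = C at *
  have hA : A = C - 1 ∨ A = C + 1 := by omega
  have hB : B = C - 1 ∨ B = C + 1 := by omega
  clear e1 e2
  rcases hA with rfl | rfl <;> rcases hB with rfl | rfl
  all_goals
    by_cases hp : (C - x) % 2 = 0
    · rcases lt_trichotomy C x with hl | hl | hl
      · split_ifs <;> omega
      · subst hl
        split_ifs <;> omega
      · split_ifs <;> omega
    · split_ifs <;> omega

lemma wave_zero (n : ℕ) (D : ℕ → ℤ → ℤ) (B : ℤ) (h0 : ∀ x, D 0 x = 0) (h1 : ∀ x, D (n + 1) x = 0)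
    (hw : ∀ r x, 1 ≤ r → r ≤ n → D (r - 1) x + D (r + 1) x - D r (x - 1) - D r (x + 1) = 0)
    (hB : ∀ r x, r ≤ n + 1 → x < B → D r x = 0) : ∀ r x, r ≤ n + 1 → D r x = 0 := by
  have key : ∀ m : ℕ, ∀ r x, r ≤ n + 1 → x < B + m → D r x = 0 := by
    intro m
    induction m with
    | zero => intro r x hr hx; exact hB r x hr (by simpa using hx)
    | succ m ih =>
      intro r x hr hx
      push_cast at hx
      by_cases hr0 : r = 0
      · rw [hr0, h0]
      by_cases hr1 : r = n + 1
      · rw [hr1, h1]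
      have := hw r (x - 1) (by omega) (by omega)
      rw [ih (r - 1) (x - 1) (by omega) (by omega), ih (r + 1) (x - 1) (by omega) (by omega),
        ih r (x - 1 - 1) (by omega) (by omega), sub_add_cancel] at this
      omega
  intro r x hr
  exact key (x - B + 1).toNat r x hr (by omega)

theorem stmt19 (n : ℕ) (hn : 1 ≤ n) (k : ℕ) (hk : 1 ≤ k)
    (idx : ℕ → ℕ) (c : ℕ → ℤ)
    (hidx : ∀ t : ℕ, 1 ≤ t → t ≤ k → 1 ≤ idx t ∧ idx t ≤ n)
    (hmono : ∀ t : ℕ, 1 ≤ t → t < k → c t < c (t + 1))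
    (hsnake : ∀ t : ℕ, 2 ≤ t → t ≤ k → c t - c (t - 1) ∈ Ssn (idx t) (idx (t - 1)) n)
    (p g : ℕ → ℕ → ℤ)
    (hp : IsTuple n k idx c p)
    (hg : IsTuple n k (fun t => n + 1 - idx t) (fun t => c t - (n : ℤ) - 1) g)
    (hsum : (∑ t ∈ Finset.Icc 1 k, wt n (p t)) + (∑ t ∈ Finset.Icc 1 k, wt n (g t)) = 0) :
    ∀ t : ℕ, 1 ≤ t → t ≤ k →
      wt n (p t) = Finsupp.single (((idx t : ℕ) : ℤ), c t) 1 ∧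
      wt n (g t) = -Finsupp.single (((idx t : ℕ) : ℤ), c t) 1 := by
  have hc : ∀ d t, 1 ≤ t → t + d ≤ k → c t ≤ c (t + d) := by
    intro d
    induction d with
    | zero => intro t _ _; simp
    | succ d ih =>
      intro t h1 h2
      have e1 := ih t h1 (by omega)
      have e2 := hmono (t + d) (by omega) (by omega)
      rw [← add_assoc]; omega
  have hcle : ∀ t u, 1 ≤ t → t ≤ u → u ≤ k → c t ≤ c u := by
    intro t u h1 h2 h3
    have := hc (u - t) t h1 (by omega)
    rwa [show t + (u - t) = u by omega] at this
  obtain ⟨hpP, hpN⟩ := hp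
  obtain ⟨hgP, -⟩ := hg
  let P : ℕ → ℕ → ℤ := fun t r => c t + |(r : ℤ) - idx t|
  let G : ℕ → ℕ → ℤ := fun t r => c t - |(r : ℤ) - idx t|
  have PP : ∀ t, 1 ≤ t → t ≤ k → IsPath n (idx t) (c t) (P t) := fun t h1 h2 =>
    path_top n (idx t) (hidx t h1 h2).1 (hidx t h1 h2).2 (c t)
  have GP : ∀ t, 1 ≤ t → t ≤ k → IsPath n (n + 1 - idx t) (c t - (n : ℤ) - 1) (G t) :=
    fun t h1 h2 => path_bot n (idx t) (hidx t h1 h2).1 (hidx t h1 h2).2 (c t)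
  have wP : ∀ t, 1 ≤ t → t ≤ k → wt n (P t) = Finsupp.single (((idx t : ℕ) : ℤ), c t) 1 :=
    fun t h1 h2 => wt_top n (idx t) (hidx t h1 h2).1 (hidx t h1 h2).2 (c t)
  have wG : ∀ t, 1 ≤ t → t ≤ k → wt n (G t) = -Finsupp.single (((idx t : ℕ) : ℤ), c t) 1 :=
    fun t h1 h2 => wt_bot n (idx t) (hidx t h1 h2).1 (hidx t h1 h2).2 (c t)
  have Pp : ∀ t, 1 ≤ t → t ≤ k → ∀ r, r ≤ n + 1 → P t r ≤ p t r := fun t h1 h2 r hr =>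
    top_le (hpP t h1 h2) r hr
  have gG : ∀ t, 1 ≤ t → t ≤ k → ∀ r, r ≤ n + 1 → g t r ≤ G t r := fun t h1 h2 r hr =>
    le_bot' (hidx t h1 h2).2 (hgP t h1 h2) r hr
  have cP : ∀ t r, c t ≤ P t r := fun t r => by
    have := abs_nonneg ((r : ℤ) - idx t)
    simp only [P]; omega
  have Gc : ∀ t r, G t r ≤ c t := fun t r => by
    have := abs_nonneg ((r : ℤ) - idx t)
    simp only [G]; omega
  have Pi : ∀ t, P t (idx t) = c t := fun t => by simp [P]
  have Gi : ∀ t, G t (idx t) = c t := fun t => by simp [G]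
  have parp : ∀ t, 1 ≤ t → t ≤ k → ∀ r, r ≤ n + 1 → (p t r - P t r) % 2 = 0 :=
    fun t h1 h2 r hr => par (hpP t h1 h2) (PP t h1 h2) r hr
  have parg : ∀ t, 1 ≤ t → t ≤ k → ∀ r, r ≤ n + 1 → (g t r - G t r) % 2 = 0 :=
    fun t h1 h2 r hr => par (hgP t h1 h2) (GP t h1 h2) r hr
  -- differences
  let a : ℕ → ℕ → ℤ → ℤ := fun t r x => hh (p t) r x - hh (P t) r x
  let b : ℕ → ℕ → ℤ → ℤ := fun t r x => hh (G t) r x - hh (g t) r x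
  have a_nn : ∀ t, 1 ≤ t → t ≤ k → ∀ r, r ≤ n + 1 → ∀ x, 0 ≤ a t r x := by
    intro t h1 h2 r hr x
    have e1 := Pp t h1 h2 r hr
    have e2 := parp t h1 h2 r hr
    simp only [a, hh]
    split_ifs <;> omega
  have b_nn : ∀ t, 1 ≤ t → t ≤ k → ∀ r, r ≤ n + 1 → ∀ x, 0 ≤ b t r x := by
    intro t h1 h2 r hr x
    have e1 := gG t h1 h2 r hr
    have e2 := parg t h1 h2 r hr
    simp only [b, hh]
    split_ifs <;> omega
  have a_pos : ∀ t, 1 ≤ t → t ≤ k → ∀ r, r ≤ n + 1 → ∀ x, 0 < a t r x → P t r ≤ x ∧ x < p t r := by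
    intro t h1 h2 r hr x
    have e1 := Pp t h1 h2 r hr
    have e2 := parp t h1 h2 r hr
    simp only [a, hh]
    split_ifs <;> omega
  have b_pos : ∀ t, 1 ≤ t → t ≤ k → ∀ r, r ≤ n + 1 → ∀ x, 0 < b t r x → g t r ≤ x ∧ x < G t r := by
    intro t h1 h2 r hr x
    have e1 := gG t h1 h2 r hr
    have e2 := parg t h1 h2 r hr
    simp only [b, hh]
    split_ifs <;> omega
  have glow : ∀ t, 1 ≤ t → t ≤ k → ∀ r, r ≤ n + 1 → c 1 - 2 * n - 2 ≤ g t r := by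
    intro t h1 h2 r hr
    have e0 := (hgP t h1 h2).1
    have e1 := lip (hgP t h1 h2) 0 r (by omega)
    rw [zero_add] at e1
    have e2 := hcle 1 t le_rfl h1 h2
    have e3 := hidx t h1 h2
    simp only at e0
    omega
  have bal : ∀ r x, r ≤ n + 1 →
      (∑ t ∈ Finset.Icc 1 k, (a t r x - b t r x)) = 0 := by
    apply wave_zero n (fun r x => ∑ t ∈ Finset.Icc 1 k, (a t r x - b t r x)) (c 1 - 2 * n - 2)
    · intro x
      apply Finset.sum_eq_zero
      intro t ht
      rw [Finset.mem_Icc] at ht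
      have e1 := (hpP t ht.1 ht.2).1.trans (PP t ht.1 ht.2).1.symm
      have e2 := (hgP t ht.1 ht.2).1.trans (GP t ht.1 ht.2).1.symm
      simp only [a, b, hh, e1, e2]; ring
    · intro x
      apply Finset.sum_eq_zero
      intro t ht
      rw [Finset.mem_Icc] at ht
      have e1 := (hpP t ht.1 ht.2).2.1.trans (PP t ht.1 ht.2).2.1.symm
      have e2 := (hgP t ht.1 ht.2).2.1.trans (GP t ht.1 ht.2).2.1.symm
      simp only [a, b, hh, e1, e2]; ring
    · intro r x h1 h2
      have hs := DFunLike.congr_fun hsum ((r : ℤ), x)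
      rw [Finsupp.add_apply, Finsupp.finsetSum_apply, Finsupp.finsetSum_apply,
        ← Finset.sum_add_distrib, Finsupp.zero_apply] at hs
      rw [← Finset.sum_add_distrib, ← Finset.sum_sub_distrib, ← Finset.sum_sub_distrib, ← hs]
      apply Finset.sum_congr rfl
      intro t ht
      rw [Finset.mem_Icc] at ht
      have e1 := hh_wave (hpP t ht.1 ht.2) r h1 h2 x
      have e2 := hh_wave (hgP t ht.1 ht.2) r h1 h2 x
      have e3 := hh_wave (PP t ht.1 ht.2) r h1 h2 x
      have e4 := hh_wave (GP t ht.1 ht.2) r h1 h2 x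
      rw [wP t ht.1 ht.2] at e3
      rw [wG t ht.1 ht.2, Finsupp.neg_apply] at e4
      simp only [a, b]
      linarith
    · intro r x hr hx
      apply Finset.sum_eq_zero
      intro t ht
      rw [Finset.mem_Icc] at ht
      obtain ⟨h1, h2⟩ := ht
      have e1 := glow t h1 h2 r hr
      have e2 := hcle 1 t le_rfl h1 h2
      have e3 := cP t r
      have A := a_nn t h1 h2 r hr x
      have B := b_nn t h1 h2 r hr x
      have A' := a_pos t h1 h2 r hr x
      have B' := b_pos t h1 h2 r hr x
      omega
  have a_to_b : ∀ r x, r ≤ n + 1 → ∀ u, 1 ≤ u → u ≤ k → 0 < a u r x →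
      ∃ v, 1 ≤ v ∧ v ≤ k ∧ 0 < b v r x := by
    intro r x hr u h1 h2 hu
    by_contra hcon
    push Not at hcon
    have : 0 < ∑ t ∈ Finset.Icc 1 k, (a t r x - b t r x) := by
      apply Finset.sum_pos'
      · intro t ht
        rw [Finset.mem_Icc] at ht
        have := hcon t ht.1 ht.2
        have := a_nn t ht.1 ht.2 r hr x
        omega
      · refine ⟨u, Finset.mem_Icc.2 ⟨h1, h2⟩, ?_⟩
        have := hcon u h1 h2
        omega
    have := bal r x hr
    omega
  have b_to_a : ∀ r x, r ≤ n + 1 → ∀ u, 1 ≤ u → u ≤ k → 0 < b u r x →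
      ∃ v, 1 ≤ v ∧ v ≤ k ∧ 0 < a v r x := by
    intro r x hr u h1 h2 hu
    by_contra hcon
    push Not at hcon
    have : ∑ t ∈ Finset.Icc 1 k, (a t r x - b t r x) < 0 := by
      apply Finset.sum_neg'
      · intro t ht
        rw [Finset.mem_Icc] at ht
        have := hcon t ht.1 ht.2
        have := b_nn t ht.1 ht.2 r hr x
        omega
      · refine ⟨u, Finset.mem_Icc.2 ⟨h1, h2⟩, ?_⟩
        have := hcon u h1 h2
        omega
    have := bal r x hr
    omega
  -- nontrivial paths are nontrivial at the extremal point
  have gtriv : ∀ t, 1 ≤ t → t ≤ k → g t (idx t) = c t → ∀ r, r ≤ n + 1 → g t r = G t r := by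
    intro t h1 h2 h r hr
    have e := lip_abs (hgP t h1 h2) (idx t) r (by have := hidx t h1 h2; omega) hr
    have e' := gG t h1 h2 r hr
    rw [h, abs_sub_comm] at e
    simp only [G] at e' ⊢
    omega
  have ptriv : ∀ t, 1 ≤ t → t ≤ k → p t (idx t) = c t → ∀ r, r ≤ n + 1 → p t r = P t r := by
    intro t h1 h2 h r hr
    have e := lip_abs (hpP t h1 h2) r (idx t) hr (by have := hidx t h1 h2; omega)
    have e' := Pp t h1 h2 r hr
    rw [h] at e
    simp only [P] at e' ⊢
    omega
  have p_to_g : ∀ u, 1 ≤ u → u ≤ k → p u (idx u) ≠ c u →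
      ∃ v, u < v ∧ v ≤ k ∧ g v (idx v) ≠ c v := by
    intro u h1 h2 hu
    have hi : idx u ≤ n + 1 := by have := hidx u h1 h2; omega
    have e1 := Pp u h1 h2 (idx u) hi
    have e2 := parp u h1 h2 (idx u) hi
    rw [Pi] at e1 e2
    have hpos : 0 < a u (idx u) (c u + 1) := by
      simp only [a, hh, Pi]
      split_ifs <;> omega
    obtain ⟨v, v1, v2, hv⟩ := a_to_b _ _ hi u h1 h2 hpos
    have hv' := b_pos v v1 v2 _ hi _ hv
    have e3 := Gc v (idx u)
    refine ⟨v, ?_, v2, ?_⟩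
    · by_contra hcon
      have := hcle v u v1 (by omega) h2
      omega
    · intro h
      have := gtriv v v1 v2 h (idx u) hi
      omega
  have gall : ∀ m u, 1 ≤ u → u ≤ k → k - u < m → g u (idx u) = c u := by
    intro m
    induction m with
    | zero => intro u _ _ h; omega
    | succ m ih =>
      intro u h1 h2 hm
      by_contra hu
      have hi : idx u ≤ n + 1 := by have := hidx u h1 h2; omega
      have e1 := gG u h1 h2 (idx u) hi
      have e2 := parg u h1 h2 (idx u) hi
      rw [Gi] at e1 e2
      have hpos : 0 < b u (idx u) (c u - 1) := by
        simp only [b, hh, Gi]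
        split_ifs <;> omega
      obtain ⟨t, t1, t2, ht⟩ := b_to_a _ _ hi u h1 h2 hpos
      have ht' := a_pos t t1 t2 _ hi _ ht
      have e3 := cP t (idx u)
      have htu : t < u := by
        by_contra hcon
        have := hcle u t h1 (by omega) t2
        omega
      have e4 := hpN t u t1 htu h2 (idx u) hi
      obtain ⟨v, v1, v2, hv⟩ := p_to_g u h1 h2 (by omega)
      exact hv (ih v (by omega) v2 (by omega))
  have gall' : ∀ u, 1 ≤ u → u ≤ k → g u (idx u) = c u := fun u h1 h2 =>
    gall (k + 1) u h1 h2 (by omega)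
  intro t h1 h2
  constructor
  · rw [← wP t h1 h2]
    apply wt_congr
    apply ptriv t h1 h2
    by_contra h
    obtain ⟨v, v1, v2, hv⟩ := p_to_g t h1 h2 h
    exact hv (gall' v (by omega) v2)
  · rw [← wG t h1 h2]
    apply wt_congr
    exact gtriv t h1 h2 (gall' t h1 h2)
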